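/- Let g ∈ G and let g₀, g₁ be its sections. Then g₀, g₁ ∈ G, and: if g has a reduced decomposition of type (i), then ℓ(g₀) ≤ (ℓ(g) − 1)/2 and ℓ(g₁) ≤ (ℓ(g) − 1)/2; if g has a reduced decomposition of type (ii) or of type (iii), then ℓ(g₀) ≤ ℓ(g)/2 and ℓ(g₁) ≤ ℓ(g)/2; if g has a reduced decomposition of type (iv), then ℓ(g₀) ≤ (ℓ(g) + 1)/2 and ℓ(g₁) ≤ (ℓ(g) + 1)/2. -/

import Mathlib

namespace Grig

def aFun : List Bool → List Bool
  | [] => []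
  | x :: v => (!x) :: v

mutual
  def bFun : List Bool → List Bool
    | [] => []
    | false :: v => false :: aFun v
    | true :: v => true :: cFun v
  def cFun : List Bool → List Bool
    | [] => []
    | false :: v => false :: aFun v
    | true :: v => true :: dFun v
  def dFun : List Bool → List Bool
    | [] => []
    | false :: v => false :: v
    | true :: v => true :: bFun v
end

theorem aFun_invol : Function.Involutive aFun := by
  intro v; cases v <;> simp [aFun]

theorem bcd_invol : ∀ v, bFun (bFun v) = v ∧ cFun (cFun v) = v ∧ dFun (dFun v) = v := by
  intro v
  induction v with
  | nil => simp [bFun, cFun, dFun]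
  | cons x v ih =>
    cases x <;> simp [bFun, cFun, dFun, aFun_invol v, ih.1, ih.2.1, ih.2.2]

/-- The automorphism `a` of the binary tree. -/
def a : Equiv.Perm (List Bool) := Function.Involutive.toPerm aFun aFun_invol

def b : Equiv.Perm (List Bool) := Function.Involutive.toPerm bFun (fun v => (bcd_invol v).1)

def c : Equiv.Perm (List Bool) := Function.Involutive.toPerm cFun (fun v => (bcd_invol v).2.1)

def d : Equiv.Perm (List Bool) := Function.Involutive.toPerm dFun (fun v => (bcd_invol v).2.2)

/-- The Grigorchuk group, as the subgroup generated by `a, b, c, d` inside the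
permutation group of the vertex set of the binary tree. -/
def grigG : Subgroup (Equiv.Perm (List Bool)) := Subgroup.closure {a, b, c, d}

end Grig

namespace Grig

/-- The four-letter alphabet `{a, b, c, d}`. -/
inductive Letter : Type
  | A | B | C | D
deriving DecidableEq

/-- Evaluation of a letter as a tree automorphism. -/
def evalLetter : Letter → Equiv.Perm (List Bool)
  | .A => a
  | .B => b
  | .C => c
  | .D => d

/-- A nonempty word over `{a, b, c, d}` is reduced if no two consecutive letters are both
`a`, and no two consecutive letters both lie in `{b, c, d}`: consecutive letters alternate
between `a` and `{b, c, d}`. -/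
def Reduced (w : List Letter) : Prop :=
  w ≠ [] ∧ w.Chain' (fun x y => (x = Letter.A) ↔ ¬(y = Letter.A))

/-- Type (i): the first and last letters are both `a`. -/
def TypeI (w : List Letter) : Prop :=
  w.head? = some Letter.A ∧ w.getLast? = some Letter.A

/-- Type (ii): the first letter is `a` and the last letter lies in `{b, c, d}`. -/
def TypeII (w : List Letter) : Prop :=
  w.head? = some Letter.A ∧ ∃ l, w.getLast? = some l ∧ l ≠ Letter.A

/-- Type (iii): the first letter lies in `{b, c, d}` and the last letter is `a`. -/
def TypeIII (w : List Letter) : Prop :=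
  (∃ l, w.head? = some l ∧ l ≠ Letter.A) ∧ w.getLast? = some Letter.A

/-- Type (iv): the first and last letters both lie in `{b, c, d}`. -/
def TypeIV (w : List Letter) : Prop :=
  (∃ l, w.head? = some l ∧ l ≠ Letter.A) ∧ ∃ l, w.getLast? = some l ∧ l ≠ Letter.A

end Grig

namespace Grig

/-- The word length of `g`: the least `n` such that `g` is a product of `n` elements of
`{a, b, c, d}`. -/
noncomputable def wlen (g : Equiv.Perm (List Bool)) : ℕ :=
  sInf {n : ℕ | ∃ l : List (Equiv.Perm (List Bool)), l.length = n ∧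
    (∀ x ∈ l, x ∈ ({a, b, c, d} : Set (Equiv.Perm (List Bool)))) ∧ l.prod = g}

end Grig

namespace Grig

/-- A reduced decomposition of `g ∈ G`: a reduced word whose product is `g` and whose
length is the word length of `g`. -/
def ReducedDecomp (w : List Letter) (g : Equiv.Perm (List Bool)) : Prop :=
  Reduced w ∧ (w.map evalLetter).prod = g ∧ w.length = wlen g

end Grig

namespace Grig

/-- Number of letters of a word lying in `{b, c, d}`. -/
def nonA : List Letter → ℕ
  | [] => 0
  | Letter.A :: w => nonA w
  | _ :: w => nonA w + 1

theorem letter_mem (s : Letter) :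
    evalLetter s ∈ ({a, b, c, d} : Set (Equiv.Perm (List Bool))) := by
  cases s <;> simp [evalLetter]

theorem prod_mem (w : List Letter) : (w.map evalLetter).prod ∈ grigG := by
  apply Subgroup.list_prod_mem
  intro x hx
  obtain ⟨s, -, rfl⟩ := List.mem_map.1 hx
  exact Subgroup.subset_closure (letter_mem s)

theorem wlen_le (w : List Letter) : wlen (w.map evalLetter).prod ≤ w.length := by
  apply Nat.sInf_le
  refine ⟨w.map evalLetter, by simp, ?_, rfl⟩
  intro x hx
  obtain ⟨s, -, rfl⟩ := List.mem_map.1 hx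
  exact letter_mem s

theorem letter_inv (s : Letter) : (evalLetter s)⁻¹ = evalLetter s := by
  cases s <;> rfl

theorem mem_word (g : Equiv.Perm (List Bool)) (hg : g ∈ grigG) :
    ∃ w : List Letter, (w.map evalLetter).prod = g := by
  induction hg using Subgroup.closure_induction with
  | mem x hx =>
    rcases hx with rfl | rfl | rfl | rfl
    · exact ⟨[Letter.A], by simp [evalLetter]⟩
    · exact ⟨[Letter.B], by simp [evalLetter]⟩
    · exact ⟨[Letter.C], by simp [evalLetter]⟩
    · exact ⟨[Letter.D], by simp [evalLetter]⟩
  | one => exact ⟨[], rfl⟩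
  | mul x y _ _ hx hy =>
    obtain ⟨u, rfl⟩ := hx
    obtain ⟨v, rfl⟩ := hy
    exact ⟨u ++ v, by simp⟩
  | inv x _ hx =>
    obtain ⟨u, rfl⟩ := hx
    refine ⟨u.reverse, ?_⟩
    rw [List.prod_inv_reverse, List.map_reverse, List.map_map]
    congr 2
    apply List.map_congr_left
    intro s _
    exact (letter_inv s).symm

theorem a_apply (v : List Bool) : a v = aFun v := rfl

theorem b_apply (v : List Bool) : b v = bFun v := rfl

theorem c_apply (v : List Bool) : c v = cFun v := rfl

theorem d_apply (v : List Bool) : d v = dFun v := rfl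

/-- Sections of a single letter: a word of length at most one, empty for `a`. -/
theorem letter_section (s : Letter) (x : Bool) :
    ∃ (l : List Letter) (y : Bool), l.length ≤ nonA [s] ∧
      ∀ v, evalLetter s (x :: v) = y :: (l.map evalLetter).prod v := by
  cases s <;> cases x
  · exact ⟨[], true, by simp, fun v => by
      simp [evalLetter, a_apply, b_apply, c_apply, d_apply, aFun, bFun, cFun, dFun]⟩
  · exact ⟨[], false, by simp, fun v => by
      simp [evalLetter, a_apply, b_apply, c_apply, d_apply, aFun, bFun, cFun, dFun]⟩
  · exact ⟨[Letter.A], false, by simp [nonA], fun v => by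
      simp [evalLetter, a_apply, b_apply, c_apply, d_apply, aFun, bFun, cFun, dFun]⟩
  · exact ⟨[Letter.C], true, by simp [nonA], fun v => by
      simp [evalLetter, a_apply, b_apply, c_apply, d_apply, aFun, bFun, cFun, dFun]⟩
  · exact ⟨[Letter.A], false, by simp [nonA], fun v => by
      simp [evalLetter, a_apply, b_apply, c_apply, d_apply, aFun, bFun, cFun, dFun]⟩
  · exact ⟨[Letter.D], true, by simp [nonA], fun v => by
      simp [evalLetter, a_apply, b_apply, c_apply, d_apply, aFun, bFun, cFun, dFun]⟩
  · exact ⟨[], false, by simp [nonA], fun v => by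
      simp [evalLetter, a_apply, b_apply, c_apply, d_apply, aFun, bFun, cFun, dFun]⟩
  · exact ⟨[Letter.B], true, by simp [nonA], fun v => by
      simp [evalLetter, a_apply, b_apply, c_apply, d_apply, aFun, bFun, cFun, dFun]⟩

theorem nonA_cons (s : Letter) (w : List Letter) : nonA (s :: w) = nonA [s] + nonA w := by
  cases s <;> simp [nonA, add_comm]

theorem word_section (w : List Letter) (x : Bool) :
    ∃ (l : List Letter) (y : Bool), l.length ≤ nonA w ∧
      ∀ v, (w.map evalLetter).prod (x :: v) = y :: (l.map evalLetter).prod v := by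
  induction w with
  | nil => exact ⟨[], x, by simp, fun v => by simp⟩
  | cons s w ih =>
    obtain ⟨l, y, hl, h⟩ := ih
    obtain ⟨l', y', hl', h'⟩ := letter_section s y
    refine ⟨l' ++ l, y', ?_, fun v => ?_⟩
    · rw [nonA_cons, List.length_append]; omega
    · simp [h, h']

/-- In an alternating word the number of letters in `{b, c, d}` is determined by the ends. -/
theorem nonA_count (w : List Letter) (hw : Reduced w) :
    2 * nonA w + (if w.head? = some Letter.A then 1 else 0)
      + (if w.getLast? = some Letter.A then 1 else 0) = w.length + 1 := by
  obtain ⟨hne, hc⟩ := hw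
  induction w with
  | nil => exact absurd rfl hne
  | cons s w ih =>
    cases w with
    | nil => cases s <;> simp [nonA]
    | cons t w =>
      have hc' := List.isChain_cons_cons.1 hc
      have := ih (by simp) hc'.2
      rw [nonA_cons, List.getLast?_cons_cons]
      have h1 := hc'.1
      simp only [List.head?_cons, List.length_cons] at this ⊢
      cases s <;> cases t <;> simp at h1 <;> simp [nonA] at this ⊢ <;> omega

theorem section_word (w : List Letter) (x z : Bool) (g h : Equiv.Perm (List Bool))
    (hw : (w.map evalLetter).prod = g) (hh : ∀ v, g (x :: v) = z :: h v) :
    h ∈ grigG ∧ wlen h ≤ nonA w := by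
  obtain ⟨l, y, hl, hv⟩ := word_section w x
  have : h = (l.map evalLetter).prod := by
    ext1 v
    have h1 := hh v
    rw [← hw, hv] at h1
    exact (List.cons.inj h1).2.symm
  subst this
  exact ⟨prod_mem l, (wlen_le l).trans hl⟩

end Grig

namespace Grig

/-- Let `g ∈ G` with sections `g₀, g₁` (characterized by `g (x :: w) = σ x :: g_x w`,
where `σ` is the induced permutation of the first level). Then `g₀, g₁ ∈ G` and:
if `g` has a reduced decomposition of type (i), then `ℓ(g₀), ℓ(g₁) ≤ (ℓ(g) - 1)/2`;
if of type (ii) or (iii), then `ℓ(g₀), ℓ(g₁) ≤ ℓ(g)/2`;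
if of type (iv), then `ℓ(g₀), ℓ(g₁) ≤ (ℓ(g) + 1)/2`. -/
theorem section_length_bounds (g g₀ g₁ : Equiv.Perm (List Bool)) (hg : g ∈ grigG)
    (σ : Equiv.Perm Bool)
    (h0 : ∀ w : List Bool, g (false :: w) = σ false :: g₀ w)
    (h1 : ∀ w : List Bool, g (true :: w) = σ true :: g₁ w) :
    g₀ ∈ grigG ∧ g₁ ∈ grigG ∧
    ((∃ w, ReducedDecomp w g ∧ TypeI w) →
      (wlen g₀ : ℝ) ≤ ((wlen g : ℝ) - 1) / 2 ∧ (wlen g₁ : ℝ) ≤ ((wlen g : ℝ) - 1) / 2) ∧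
    ((∃ w, ReducedDecomp w g ∧ (TypeII w ∨ TypeIII w)) →
      (wlen g₀ : ℝ) ≤ (wlen g : ℝ) / 2 ∧ (wlen g₁ : ℝ) ≤ (wlen g : ℝ) / 2) ∧
    ((∃ w, ReducedDecomp w g ∧ TypeIV w) →
      (wlen g₀ : ℝ) ≤ ((wlen g : ℝ) + 1) / 2 ∧ (wlen g₁ : ℝ) ≤ ((wlen g : ℝ) + 1) / 2) := by
  obtain ⟨w, hw⟩ := mem_word g hg
  refine ⟨(section_word w _ _ g g₀ hw h0).1, (section_word w _ _ g g₁ hw h1).1, ?_, ?_, ?_⟩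
  · rintro ⟨w, ⟨hr, hw, hlen⟩, hA, hB⟩
    have b0 := (section_word w _ _ g g₀ hw h0).2
    have b1 := (section_word w _ _ g g₁ hw h1).2
    have hc := nonA_count w hr
    rw [hlen, if_pos hA, if_pos hB] at hc
    have e0 : 2 * wlen g₀ + 1 ≤ wlen g := by omega
    have e1 : 2 * wlen g₁ + 1 ≤ wlen g := by omega
    have e0' : 2 * (wlen g₀ : ℝ) + 1 ≤ wlen g := by exact_mod_cast e0
    have e1' : 2 * (wlen g₁ : ℝ) + 1 ≤ wlen g := by exact_mod_cast e1
    constructor <;> linarith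
  · rintro ⟨w, ⟨hr, hw, hlen⟩, hT⟩
    have b0 := (section_word w _ _ g g₀ hw h0).2
    have b1 := (section_word w _ _ g g₁ hw h1).2
    have hc := nonA_count w hr
    have hc' : 2 * nonA w = wlen g := by
      rcases hT with ⟨hA, l, hB, hl⟩ | ⟨⟨l, hA, hl⟩, hB⟩ <;>
        simp [hlen, hA, hB, hl] at hc <;> omega
    have e0 : 2 * wlen g₀ ≤ wlen g := by omega
    have e1 : 2 * wlen g₁ ≤ wlen g := by omega
    have e0' : 2 * (wlen g₀ : ℝ) ≤ wlen g := by exact_mod_cast e0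
    have e1' : 2 * (wlen g₁ : ℝ) ≤ wlen g := by exact_mod_cast e1
    constructor <;> linarith
  · rintro ⟨w, ⟨hr, hw, hlen⟩, -⟩
    have b0 := (section_word w _ _ g g₀ hw h0).2
    have b1 := (section_word w _ _ g g₁ hw h1).2
    have hc := nonA_count w hr
    rw [hlen] at hc
    have e0 : 2 * wlen g₀ ≤ wlen g + 1 := by omega
    have e1 : 2 * wlen g₁ ≤ wlen g + 1 := by omega
    have e0' : 2 * (wlen g₀ : ℝ) ≤ wlen g + 1 := by exact_mod_cast e0
    have e1' : 2 * (wlen g₁ : ℝ) ≤ wlen g + 1 := by exact_mod_cast e1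
    constructor <;> linarith

end Grig
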